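/- arXiv:1401.1930 — 6 statements merged into one kernel-verified Lean document; each statement's English description precedes it below -/
import Mathlib

section
/- Let K be a field and define R(t₁,t₂,t₃) = (t₂t₃/(t₁+t₃), t₁+t₃, t₁t₂/(t₁+t₃)) whenever t₁+t₃ ≠ 0. If t₁, t₂, t₃ ∈ K are all nonzero and t₁+t₃ ≠ 0, then the three components of R(t₁,t₂,t₃) are nonzero, the sum of its first and third components equals t₂ (in particular is nonzero), and R(R(t₁,t₂,t₃)) = (t₁,t₂,t₃). -/
/-- The rational transformation of the Berenstein–Fomin–Zelevinsky 3-braid move: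
`R(t₁,t₂,t₃) = (t₂t₃/(t₁+t₃), t₁+t₃, t₁t₂/(t₁+t₃))`. -/
def R {K : Type*} [Field K] : K × K × K → K × K × K :=
  fun t => (t.2.1 * t.2.2 / (t.1 + t.2.2), t.1 + t.2.2, t.1 * t.2.1 / (t.1 + t.2.2))

/-- **The BFZ transition law is an involution on its domain of definition.**
If `t₁, t₂, t₃` are all nonzero and `t₁ + t₃ ≠ 0`, then all three components of
`R(t₁,t₂,t₃)` are nonzero, the sum of the first and third components equals `t₂`
(in particular is nonzero), and `R(R(t₁,t₂,t₃)) = (t₁,t₂,t₃)`. -/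
theorem R_involutive {K : Type*} [Field K] (t₁ t₂ t₃ : K)
    (h₁ : t₁ ≠ 0) (h₂ : t₂ ≠ 0) (h₃ : t₃ ≠ 0) (h : t₁ + t₃ ≠ 0) :
    (R (t₁, t₂, t₃)).1 ≠ 0 ∧ (R (t₁, t₂, t₃)).2.1 ≠ 0 ∧ (R (t₁, t₂, t₃)).2.2 ≠ 0 ∧
      (R (t₁, t₂, t₃)).1 + (R (t₁, t₂, t₃)).2.2 = t₂ ∧
      R (R (t₁, t₂, t₃)) = (t₁, t₂, t₃) := by
  have hsum : t₂ * t₃ / (t₁ + t₃) + t₁ * t₂ / (t₁ + t₃) = t₂ := by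
    rw [← add_div, div_eq_iff h]
    ring
  refine ⟨div_ne_zero (mul_ne_zero h₂ h₃) h, h, div_ne_zero (mul_ne_zero h₁ h₂) h, hsum, ?_⟩
  simp only [R, hsum, Prod.mk.injEq, true_and]
  constructor
  · rw [mul_div_cancel₀ _ h, mul_div_cancel_right₀ _ h₂]
  · rw [div_mul_cancel₀ _ h, mul_div_cancel_left₀ _ h₂]
end

section
/- Let k be a field, F = k((ε)) the field of formal Laurent series, and O = k[[ε]] its ring of integers. For every upper unitriangular 3×3 matrix u over F, there exists an upper unitriangular 3×3 matrix a with all entries in O such that the product w = u·a satisfies w₁₂ ≠ 0, w₁₃ ≠ 0, and w₁₂w₂₃ − w₁₃ ≠ 0. -/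
/-- Membership in the ring of integers `O = k[[ε]]` of `F = k((ε))`:
a Laurent series lies in `O` iff it is (the image of) a formal power series. -/
def memO {k : Type*} [Field k] (x : LaurentSeries k) : Prop :=
  ∃ p : PowerSeries k, HahnSeries.ofPowerSeries ℤ k p = x

theorem memO_zero {k : Type*} [Field k] : memO (0 : LaurentSeries k) := ⟨0, map_zero _⟩

theorem memO_one {k : Type*} [Field k] : memO (1 : LaurentSeries k) := ⟨1, map_one _⟩

/-- The ring of integers is not covered by any two elements of `F`. -/
theorem exists_memO_ne_ne {k : Type*} [Field k] (s t : LaurentSeries k) :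
    ∃ q, memO q ∧ q ≠ s ∧ q ≠ t := by
  set X : LaurentSeries k := HahnSeries.ofPowerSeries ℤ k PowerSeries.X
  have hX0 : X ≠ 0 := fun h =>
    PowerSeries.X_ne_zero (HahnSeries.ofPowerSeries_injective (h.trans (map_zero _).symm))
  have hX1 : X ≠ 1 := fun h => by
    have h' : (PowerSeries.X : PowerSeries k) = 1 :=
      HahnSeries.ofPowerSeries_injective (h.trans (map_one _).symm)
    simpa using congrArg PowerSeries.constantCoeff h'
  have h01 : (0 : LaurentSeries k) ≠ 1 := zero_ne_one
  by_contra! h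
  have h0 := h 0 memO_zero
  have h1 := h 1 memO_one
  have h2 := h X ⟨PowerSeries.X, rfl⟩
  by_cases hs0 : 0 = s
  · subst hs0
    exact hX1 ((h2 hX0).trans (h1 h01.symm).symm)
  by_cases hs1 : 1 = s
  · subst hs1
    exact hX0 ((h2 hX1).trans (h0 hs0).symm)
  exact h01 ((h0 hs0).trans (h1 hs1).symm)

/-- **Genericity of chamber minors over `k((ε))`.**
For every upper unitriangular 3×3 matrix `u` over `F = k((ε))` there is an upper
unitriangular 3×3 matrix `a` with entries in `O = k[[ε]]` such that `w = u·a`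
satisfies `w₁₂ ≠ 0`, `w₁₃ ≠ 0` and `w₁₂w₂₃ − w₁₃ ≠ 0`. -/
theorem chamber_minor_genericity {k : Type*} [Field k]
    (u : Matrix (Fin 3) (Fin 3) (LaurentSeries k))
    (hu : u 0 0 = 1 ∧ u 1 1 = 1 ∧ u 2 2 = 1 ∧ u 1 0 = 0 ∧ u 2 0 = 0 ∧ u 2 1 = 0) :
    ∃ a : Matrix (Fin 3) (Fin 3) (LaurentSeries k),
      (a 0 0 = 1 ∧ a 1 1 = 1 ∧ a 2 2 = 1 ∧ a 1 0 = 0 ∧ a 2 0 = 0 ∧ a 2 1 = 0) ∧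
      (∀ i j, memO (a i j)) ∧
      (u * a) 0 1 ≠ 0 ∧ (u * a) 0 2 ≠ 0 ∧
        (u * a) 0 1 * (u * a) 1 2 - (u * a) 0 2 ≠ 0 := by
  obtain ⟨h00, h11, -, h10, -, -⟩ := hu
  obtain ⟨p, hp, hpx, -⟩ := exists_memO_ne_ne (-u 0 1) 0
  obtain ⟨q, hq, hq1, hq2⟩ := exists_memO_ne_ne (-u 0 2) ((p + u 0 1) * u 1 2 - u 0 2)
  refine ⟨!![1, p, q; 0, 1, 0; 0, 0, 1], by simp, ?_, ?_, ?_, ?_⟩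
  · intro i j
    fin_cases i <;> fin_cases j <;> simp [memO_zero, memO_one, hp, hq]
  · simp only [Matrix.mul_apply, Fin.sum_univ_three]
    simpa [h00, add_eq_zero_iff_eq_neg] using hpx
  · simp only [Matrix.mul_apply, Fin.sum_univ_three]
    simpa [h00, add_eq_zero_iff_eq_neg] using hq1
  · simp only [Matrix.mul_apply, Fin.sum_univ_three]
    simp [h00, h11, h10]
    grind
end

section
/- Let k be a field, F = k((ε)) the field of formal Laurent series, O = k[[ε]] its ring of integers, and val : F → ℤ ∪ {∞} the ε-adic valuation normalized by val(ε) = 1 and val(0) = ∞. Let γ₁, γ₂, γ₃ ∈ O, let n₁, n₂ be integers, and let a, b, c ∈ F. Set v = [[1,a,c],[0,1,b],[0,0,1]], γ = diag(γ₁,γ₂,γ₃), and d = diag(ε^{n₁}, 1, ε^{−n₂}). Then all nine entries of the matrix d⁻¹·(v·γ·v⁻¹)·d lie in O if and only if val(a·(γ₁−γ₂)) ≥ n₁, val(b·(γ₂−γ₃)) ≥ n₂, and val(c·(γ₃−γ₁) + a·b·(γ₁−γ₂)) ≥ n₁+n₂. -/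
/-- The `ε`-adic valuation on `F = k((ε))`, with `val 0 = ∞` and `val ε = 1`. -/
noncomputable def val {k : Type*} [Field k] (x : LaurentSeries k) : WithTop ℤ :=
  x.orderTop

/-- The uniformizer `ε` of `k((ε))`. -/
noncomputable def eps (k : Type*) [Field k] : LaurentSeries k :=
  HahnSeries.single (1 : ℤ) (1 : k)

theorem memO_iff_zero_le_val {k : Type*} [Field k] (x : LaurentSeries k) :
    memO x ↔ 0 ≤ val x := by
  unfold memO val
  constructor
  · rintro ⟨p, rfl⟩
    by_contra! h
    obtain ⟨n, hn⟩ := WithTop.ne_top_iff_exists.mp h.ne_top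
    have hn0 : n < 0 := by rw [← hn] at h; exact_mod_cast h
    have hc := HahnSeries.coeff_orderTop_ne hn.symm
    rw [PowerSeries.coeff_coe, if_pos hn0] at hc
    exact hc rfl
  · intro h
    refine ⟨PowerSeries.mk fun n => x.coeff n, ?_⟩
    ext n
    rw [PowerSeries.coeff_coe]
    split_ifs with hn
    · exact (HahnSeries.coeff_eq_zero_of_lt_orderTop
        (lt_of_lt_of_le (by exact_mod_cast hn) h)).symm
    · simp [abs_of_nonneg (not_lt.mp hn)]

theorem memO_neg_iff {k : Type*} [Field k] {x : LaurentSeries k} : memO (-x) ↔ memO x := by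
  simp only [memO_iff_zero_le_val, val, HahnSeries.orderTop_neg]

theorem eps_ne_zero (k : Type*) [Field k] : eps k ≠ 0 :=
  HahnSeries.single_ne_zero one_ne_zero

theorem memO_mul_eps_zpow_neg_iff {k : Type*} [Field k] (x : LaurentSeries k) (n : ℤ) :
    memO (x * eps k ^ (-n)) ↔ (n : WithTop ℤ) ≤ val x := by
  have hval : val (x * eps k ^ (-n)) = val x + ((-n : ℤ) : WithTop ℤ) := by
    rw [eps, ← RatFunc.single_zpow, val, HahnSeries.orderTop_mul,
      HahnSeries.orderTop_single one_ne_zero, val]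
  rw [memO_iff_zero_le_val, hval]
  induction val x using WithTop.recTopCoe with
  | top => simp
  | coe m =>
    norm_cast
    omega

theorem inv_unitriangular_fin_three {R : Type*} [CommRing R] (a b c : R) :
    (!![1, a, c; 0, 1, b; 0, 0, 1] : Matrix (Fin 3) (Fin 3) R)⁻¹ =
      !![1, -a, a * b - c; 0, 1, -b; 0, 0, 1] := by
  refine Matrix.inv_eq_right_inv ?_
  ext i j
  fin_cases i <;> fin_cases j <;> simp [Matrix.mul_apply, Fin.sum_univ_three]
  ring

theorem unitriangular_conj_diagonal_fin_three {R : Type*} [CommRing R] (a b c x y z : R) :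
    !![1, a, c; 0, 1, b; 0, 0, 1] * Matrix.diagonal ![x, y, z] *
        (!![1, a, c; 0, 1, b; 0, 0, 1])⁻¹ =
      !![x, -(a * (x - y)), c * (z - x) + a * b * (x - y);
        0, y, -(b * (y - z));
        0, 0, z] := by
  rw [inv_unitriangular_fin_three]
  ext i j
  rw [Matrix.mul_apply]
  simp only [Matrix.mul_diagonal, Fin.sum_univ_three]
  fin_cases i <;> fin_cases j <;> simp <;> ring

theorem inv_diagonal_fin_three {K : Type*} [Field K] {x y z : K}
    (hx : x ≠ 0) (hy : y ≠ 0) (hz : z ≠ 0) :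
    (Matrix.diagonal ![x, y, z])⁻¹ = Matrix.diagonal ![x⁻¹, y⁻¹, z⁻¹] := by
  refine Matrix.inv_eq_right_inv ?_
  ext i j
  fin_cases i <;> fin_cases j <;> simp [hx, hy, hz]

/-- **Membership computation for the contracting cell at `B₀`.**
For `γ₁, γ₂, γ₃ ∈ O`, integers `n₁, n₂`, and `a, b, c ∈ F`, with
`v = [[1,a,c],[0,1,b],[0,0,1]]`, `γ = diag(γ₁,γ₂,γ₃)` and `d = diag(ε^{n₁}, 1, ε^{−n₂})`,
all nine entries of `d⁻¹·(v·γ·v⁻¹)·d` lie in `O` if and only if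
`val(a(γ₁−γ₂)) ≥ n₁`, `val(b(γ₂−γ₃)) ≥ n₂` and
`val(c(γ₃−γ₁) + ab(γ₁−γ₂)) ≥ n₁+n₂`. -/
theorem springer_cell_membership_B0 {k : Type*} [Field k]
    (γ₁ γ₂ γ₃ : LaurentSeries k) (hγ₁ : memO γ₁) (hγ₂ : memO γ₂) (hγ₃ : memO γ₃)
    (n₁ n₂ : ℤ) (a b c : LaurentSeries k) :
    (∀ i j : Fin 3,
        memO (((Matrix.diagonal ![eps k ^ n₁, 1, eps k ^ (-n₂)])⁻¹ *
          (!![1, a, c; 0, 1, b; 0, 0, 1] * Matrix.diagonal ![γ₁, γ₂, γ₃] *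
            (!![1, a, c; 0, 1, b; 0, 0, 1])⁻¹) *
          Matrix.diagonal ![eps k ^ n₁, 1, eps k ^ (-n₂)]) i j)) ↔
      ((n₁ : WithTop ℤ) ≤ val (a * (γ₁ - γ₂)) ∧
        (n₂ : WithTop ℤ) ≤ val (b * (γ₂ - γ₃)) ∧
        ((n₁ + n₂ : ℤ) : WithTop ℤ) ≤ val (c * (γ₃ - γ₁) + a * b * (γ₁ - γ₂))) := by
  have he := eps_ne_zero k
  have hconj : (Matrix.diagonal ![eps k ^ n₁, 1, eps k ^ (-n₂)])⁻¹ *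
      (!![1, a, c; 0, 1, b; 0, 0, 1] * Matrix.diagonal ![γ₁, γ₂, γ₃] *
        (!![1, a, c; 0, 1, b; 0, 0, 1])⁻¹) *
      Matrix.diagonal ![eps k ^ n₁, 1, eps k ^ (-n₂)] =
      !![γ₁, -(a * (γ₁ - γ₂) * eps k ^ (-n₁)),
          (c * (γ₃ - γ₁) + a * b * (γ₁ - γ₂)) * eps k ^ (-(n₁ + n₂));
        0, γ₂, -(b * (γ₂ - γ₃) * eps k ^ (-n₂));
        0, 0, γ₃] := by
    rw [unitriangular_conj_diagonal_fin_three,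
      inv_diagonal_fin_three (zpow_ne_zero _ he) one_ne_zero (zpow_ne_zero _ he)]
    ext1 i j
    rw [Matrix.mul_diagonal, Matrix.diagonal_mul]
    fin_cases i <;> fin_cases j <;> simp [zpow_add₀ he] <;> field [zpow_ne_zero n₁ he, zpow_ne_zero n₂ he]
  simp only [hconj, Fin.forall_fin_succ, Fin.forall_fin_zero]
  simp [-zpow_neg, -neg_add_rev, memO_neg_iff, memO_mul_eps_zpow_neg_iff, memO_zero,
    hγ₁, hγ₂, hγ₃]
  tauto
end

section
/- Let k be a field, F = k((ε)) the field of formal Laurent series, O = k[[ε]] its ring of integers, and val : F → ℤ ∪ {∞} the ε-adic valuation normalized by val(ε) = 1 and val(0) = ∞. Let γ₁, γ₂, γ₃ ∈ O be pairwise distinct, and set c₁₂ = val(γ₁−γ₂), c₂₃ = val(γ₂−γ₃), c₁₃ = val(γ₁−γ₃). Let n₁ ≥ n₃ ≥ n₂ ≥ 0 be integers. Then the following statement holds if and only if max(0, n₁−c₁₂) + max(0, n₂−c₂₃) + c₁₂ ≥ min(n₁+n₂, n₁−n₃+c₁₃): for all a, b ∈ F with val(a) ≥ max(0, n₁−c₁₂)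 and val(b) ≥ max(0, n₂−c₂₃), there exists c ∈ F with val(c) ≥ n₁−n₃ and val(c·(γ₃−γ₁) + a·b·(γ₁−γ₂)) ≥ n₁+n₂. -/
/-- **Solvability criterion for the contracting cell `C_{B₀}` to be an affine space.**
Let `γ₁, γ₂, γ₃ ∈ O` be pairwise distinct with `c₁₂ = val(γ₁−γ₂)`, `c₂₃ = val(γ₂−γ₃)`,
`c₁₃ = val(γ₁−γ₃)`, and let `n₁ ≥ n₃ ≥ n₂ ≥ 0` be integers. Then every point `(a,b)`
of the prescribed box extends to a point `c` of the cell if and only if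
`max(0, n₁−c₁₂) + max(0, n₂−c₂₃) + c₁₂ ≥ min(n₁+n₂, n₁−n₃+c₁₃)`. -/
theorem springer_cell_criterion_B0 {k : Type*} [Field k]
    (γ₁ γ₂ γ₃ : LaurentSeries k) (hγ₁ : memO γ₁) (hγ₂ : memO γ₂) (hγ₃ : memO γ₃)
    (h12 : γ₁ ≠ γ₂) (h23 : γ₂ ≠ γ₃) (h13 : γ₁ ≠ γ₃)
    (c₁₂ c₂₃ c₁₃ : ℤ)
    (hc₁₂ : val (γ₁ - γ₂) = (c₁₂ : WithTop ℤ))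
    (hc₂₃ : val (γ₂ - γ₃) = (c₂₃ : WithTop ℤ))
    (hc₁₃ : val (γ₁ - γ₃) = (c₁₃ : WithTop ℤ))
    (n₁ n₂ n₃ : ℤ) (h13' : n₃ ≤ n₁) (h32 : n₂ ≤ n₃) (h2 : 0 ≤ n₂) :
    (∀ a b : LaurentSeries k,
        ((max 0 (n₁ - c₁₂) : ℤ) : WithTop ℤ) ≤ val a →
        ((max 0 (n₂ - c₂₃) : ℤ) : WithTop ℤ) ≤ val b →
        ∃ c : LaurentSeries k,
          ((n₁ - n₃ : ℤ) : WithTop ℤ) ≤ val c ∧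
          ((n₁ + n₂ : ℤ) : WithTop ℤ) ≤ val (c * (γ₃ - γ₁) + a * b * (γ₁ - γ₂))) ↔
      min (n₁ + n₂) (n₁ - n₃ + c₁₃) ≤ max 0 (n₁ - c₁₂) + max 0 (n₂ - c₂₃) + c₁₂ := by
  have val_mul (x y : LaurentSeries k) : val (x * y) = val x + val y :=
    HahnSeries.orderTop_mul x y
  have val_single (n : ℤ) : val (HahnSeries.single n (1 : k)) = (n : WithTop ℤ) :=
    HahnSeries.orderTop_single one_ne_zero
  have hc₃₁ : val (γ₃ - γ₁) = (c₁₃ : WithTop ℤ) := by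
    rw [← hc₁₃, ← neg_sub γ₁ γ₃]
    exact HahnSeries.orderTop_neg
  constructor
  · intro h
    obtain ⟨c, hc, hsum⟩ := h (HahnSeries.single (max 0 (n₁ - c₁₂)) 1)
      (HahnSeries.single (max 0 (n₂ - c₂₃)) 1) (val_single _).ge (val_single _).ge
    set x := HahnSeries.single (max 0 (n₁ - c₁₂)) (1 : k) *
      HahnSeries.single (max 0 (n₂ - c₂₃)) (1 : k) * (γ₁ - γ₂) with hx_def
    have hx : val x =
        ((max 0 (n₁ - c₁₂) + max 0 (n₂ - c₂₃) + c₁₂ : ℤ) : WithTop ℤ) := by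
      rw [hx_def, val_mul, val_mul, val_single, val_single, hc₁₂]
      push_cast
      rfl
    have hprod : ((n₁ - n₃ + c₁₃ : ℤ) : WithTop ℤ) ≤ val (c * (γ₃ - γ₁)) := by
      rw [val_mul, hc₃₁, WithTop.coe_add]
      gcongr
    have hsub : min (val (c * (γ₃ - γ₁) + x)) (val (c * (γ₃ - γ₁))) ≤ val x := by
      have := HahnSeries.min_orderTop_le_orderTop_sub
        (x := c * (γ₃ - γ₁) + x) (y := c * (γ₃ - γ₁))
      rwa [add_sub_cancel_left] at this
    have := (min_le_min hsum hprod).trans hsub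
    rw [hx] at this
    exact_mod_cast this
  · intro h a b ha hb
    have hx : ((max 0 (n₁ - c₁₂) + max 0 (n₂ - c₂₃) + c₁₂ : ℤ) : WithTop ℤ) ≤
        val (a * b * (γ₁ - γ₂)) := by
      rw [val_mul, val_mul, hc₁₂, WithTop.coe_add, WithTop.coe_add]
      gcongr
    rcases min_le_iff.mp h with h | h
    · refine ⟨0, ?_, ?_⟩
      · simp [val]
      · rw [zero_mul, zero_add]
        exact (WithTop.coe_le_coe.mpr h).trans hx
    · have hcancel : a * b * (γ₁ - γ₂) / (γ₁ - γ₃) * (γ₁ - γ₃) = a * b * (γ₁ - γ₂) :=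
        div_mul_cancel₀ _ (sub_ne_zero.mpr h13)
      refine ⟨a * b * (γ₁ - γ₂) / (γ₁ - γ₃), ?_, ?_⟩
      · have hle := (WithTop.coe_le_coe.mpr h).trans hx
        rw [← hcancel, val_mul, hc₁₃, WithTop.coe_add] at hle
        exact (WithTop.add_le_add_iff_right WithTop.coe_ne_top).mp hle
      · rw [← neg_sub γ₁ γ₃, mul_neg, hcancel, neg_add_cancel]
        simp [val]
end

section
/- Let k be a field, F = k((ε)) the field of formal Laurent series, O = k[[ε]] its ring of integers, and val : F → ℤ ∪ {∞} the ε-adic valuation normalized by val(ε) = 1 and val(0) = ∞. Let γ₁, γ₂, γ₃ ∈ O, let n₁, n₂ be integers, and let a, b, c ∈ F. Set v = [[1,a,c],[0,1,0],[0,b,1]], γ = diag(γ₁,γ₂,γ₃), and d = diag(ε^{n₁}, ε^{−n₂}, 1). Then all nine entries of the matrix d⁻¹·(v⁻¹·γ·v)·d lie in O if and only if val(c·(γ₁−γ₃)) ≥ n₁, val(b·(γ₂−γ₃)) ≥ n₂, and val(a·(γ₁−γ₂) + b·c·(γ₂−γ₃)) ≥ n₁+n₂. -/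
theorem memO_iff_coeff_neg {k : Type*} [Field k] {x : LaurentSeries k} :
    memO x ↔ ∀ i < 0, x.coeff i = 0 := by
  constructor
  · rintro ⟨p, rfl⟩ i hi
    rw [HahnSeries.ofPowerSeries_apply]
    refine HahnSeries.embDomain_of_notMem_range ?_
    rintro ⟨n, rfl⟩
    simp at hi
    omega
  · intro h
    refine ⟨PowerSeries.mk fun n => x.coeff n, ?_⟩
    ext i
    obtain hi | hi := lt_or_ge i 0
    · rw [h i hi, HahnSeries.ofPowerSeries_apply]
      refine HahnSeries.embDomain_of_notMem_range ?_
      rintro ⟨n, rfl⟩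
      simp at hi
      omega
    · lift i to ℕ using hi
      rw [HahnSeries.ofPowerSeries_apply_coeff, PowerSeries.coeff_mk]

theorem memO_eps_zpow_neg_mul_iff {k : Type*} [Field k] {n : ℤ} {x : LaurentSeries k} :
    memO (eps k ^ (-n) * x) ↔ (n : WithTop ℤ) ≤ val x := by
  have h : eps k ^ (-n) = HahnSeries.single (-n) 1 := by
    rw [eps, ← RatFunc.single_zpow]
  rw [memO_iff_coeff_neg, val, HahnSeries.le_orderTop_iff_forall, h]
  simp only [HahnSeries.coeff_single_mul, one_mul, WithTop.coe_lt_coe]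
  constructor
  · intro hx i hi
    simpa using hx (i - n) (by lia)
  · intro hx i hi
    exact hx _ (by lia)

theorem inv_upper_B1 {K : Type*} [Field K] (a b c : K) :
    (!![1, a, c; 0, 1, 0; 0, b, 1])⁻¹ = !![1, b * c - a, -c; 0, 1, 0; 0, -b, 1] := by
  refine Matrix.inv_eq_left_inv ?_
  ext i j
  fin_cases i <;> fin_cases j <;> simp [Matrix.mul_apply, Fin.sum_univ_three]
  ring

theorem inv_diagonal_three {K : Type*} [Field K] {x y : K} (hx : x ≠ 0) (hy : y ≠ 0) :
    (Matrix.diagonal ![x, y, 1])⁻¹ = Matrix.diagonal ![x⁻¹, y⁻¹, 1] := by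
  refine Matrix.inv_eq_left_inv ?_
  ext i j
  fin_cases i <;> fin_cases j <;> simp [hx, hy]

theorem conj_diagonal_B1 {K : Type*} [Field K] {x y : K} (hx : x ≠ 0) (hy : y ≠ 0)
    (γ₁ γ₂ γ₃ a b c : K) :
    (Matrix.diagonal ![x, y, 1])⁻¹ *
        ((!![1, a, c; 0, 1, 0; 0, b, 1])⁻¹ * Matrix.diagonal ![γ₁, γ₂, γ₃] *
          !![1, a, c; 0, 1, 0; 0, b, 1]) * Matrix.diagonal ![x, y, 1] =
      !![γ₁, x⁻¹ * y * (a * (γ₁ - γ₂) + b * c * (γ₂ - γ₃)), x⁻¹ * (c * (γ₁ - γ₃));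
        0, γ₂, 0;
        0, -(y * (b * (γ₂ - γ₃))), γ₃] := by
  rw [inv_upper_B1, inv_diagonal_three hx hy]
  simp only [Matrix.diagonal_vec3, Matrix.mul_fin_three]
  ext i j
  fin_cases i <;> fin_cases j <;> simp [hx] <;> field_simp <;> ring

/-- **Membership computation for the contracting cell at the Borel adjacent to `B₀`.**
For `γ₁, γ₂, γ₃ ∈ O`, integers `n₁, n₂`, and `a, b, c ∈ F`, with
`v = [[1,a,c],[0,1,0],[0,b,1]]`, `γ = diag(γ₁,γ₂,γ₃)` and `d = diag(ε^{n₁}, ε^{−n₂}, 1)`,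
all nine entries of `d⁻¹·(v⁻¹·γ·v)·d` lie in `O` if and only if
`val(c(γ₁−γ₃)) ≥ n₁`, `val(b(γ₂−γ₃)) ≥ n₂` and
`val(a(γ₁−γ₂) + bc(γ₂−γ₃)) ≥ n₁+n₂`. -/
theorem springer_cell_membership_B1 {k : Type*} [Field k]
    (γ₁ γ₂ γ₃ : LaurentSeries k) (hγ₁ : memO γ₁) (hγ₂ : memO γ₂) (hγ₃ : memO γ₃)
    (n₁ n₂ : ℤ) (a b c : LaurentSeries k) :
    (∀ i j : Fin 3,
        memO (((Matrix.diagonal ![eps k ^ n₁, eps k ^ (-n₂), 1])⁻¹ *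
          ((!![1, a, c; 0, 1, 0; 0, b, 1])⁻¹ * Matrix.diagonal ![γ₁, γ₂, γ₃] *
            !![1, a, c; 0, 1, 0; 0, b, 1]) *
          Matrix.diagonal ![eps k ^ n₁, eps k ^ (-n₂), 1]) i j)) ↔
      ((n₁ : WithTop ℤ) ≤ val (c * (γ₁ - γ₃)) ∧
        (n₂ : WithTop ℤ) ≤ val (b * (γ₂ - γ₃)) ∧
        ((n₁ + n₂ : ℤ) : WithTop ℤ) ≤ val (a * (γ₁ - γ₂) + b * c * (γ₂ - γ₃))) := by
  have he := eps_ne_zero k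
  rw [conj_diagonal_B1 (zpow_ne_zero _ he) (zpow_ne_zero _ he), ← zpow_neg, ← zpow_add₀ he,
    ← neg_add]
  simp only [← memO_eps_zpow_neg_mul_iff]
  simp [Fin.forall_fin_succ, memO_zero, memO_neg_iff, hγ₁, hγ₂, hγ₃, -neg_add_rev]
  tauto
end

section
/- Let k be a field, F = k((ε)) the field of formal Laurent series, O = k[[ε]] its ring of integers, and val : F → ℤ ∪ {∞} the ε-adic valuation normalized by val(ε) = 1 and val(0) = ∞. Let γ₁, γ₂, γ₃ ∈ O be pairwise distinct, and set c₁₂ = val(γ₁−γ₂), c₂₃ = val(γ₂−γ₃), c₁₃ = val(γ₁−γ₃). Let n₁ ≥ n₃ ≥ n₂ ≥ 0 be integers. Then the following statement holds if and only if max(0, n₂−c₂₃) + max(n₁−n₃, n₁−c₁₃) + c₂₃ ≥ min(n₁+n₂, c₁₂): for all b, c ∈ F with val(b) ≥ max(0, n₂−c₂₃) and val(c) ≥ max(n₁−n₃, n₁−c₁₃), there exists a ∈ F with val(a) ≥ 0 and val(a·(γ₁−γ₂) + b·c·(γ₂−γ₃)) ≥ n₁+n₂. -/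
theorem val_mul {k : Type*} [Field k] (x y : LaurentSeries k) :
    val (x * y) = val x + val y :=
  HahnSeries.orderTop_mul x y

theorem val_zero {k : Type*} [Field k] : val (0 : LaurentSeries k) = ⊤ :=
  HahnSeries.orderTop_zero

theorem exists_val_eq {k : Type*} [Field k] (m : ℤ) :
    ∃ x : LaurentSeries k, val x = (m : WithTop ℤ) :=
  ⟨HahnSeries.single m 1, HahnSeries.orderTop_single one_ne_zero⟩

theorem val_add_eq_right_of_lt {k : Type*} [Field k] {x y : LaurentSeries k}
    (h : val y < val x) : val (x + y) = val y :=
  HahnSeries.orderTop_add_eq_right h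

/-- Division with integral quotient: `x` divides `y` over the ring of integers as soon as
`val x ≤ val y`. -/
theorem exists_mul_eq_of_val_le {k : Type*} [Field k] {x y : LaurentSeries k} {d : ℤ}
    (hx : val x = (d : WithTop ℤ)) (hy : (d : WithTop ℤ) ≤ val y) :
    ∃ a : LaurentSeries k, ((0 : ℤ) : WithTop ℤ) ≤ val a ∧ a * x = y := by
  have hx0 : x ≠ 0 := by
    rintro rfl
    simp [val_zero] at hx
  refine ⟨y / x, ?_, div_mul_cancel₀ y hx0⟩
  have h : val y = val (y / x) + d := by rw [← hx, ← val_mul, div_mul_cancel₀ y hx0]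
  rw [h] at hy
  refine (WithTop.add_le_add_iff_right (WithTop.coe_ne_top (a := d))).mp ?_
  simpa using hy

/-- **Solvability criterion for a contracting cell adjacent to `B₀` to be an affine space.**
Let `γ₁, γ₂, γ₃ ∈ O` be pairwise distinct with `c₁₂ = val(γ₁−γ₂)`, `c₂₃ = val(γ₂−γ₃)`,
`c₁₃ = val(γ₁−γ₃)`, and let `n₁ ≥ n₃ ≥ n₂ ≥ 0` be integers. Then every point `(b,c)`
of the prescribed box extends to a point `a` of the cell if and only if
`max(0, n₂−c₂₃) + max(n₁−n₃, n₁−c₁₃) + c₂₃ ≥ min(n₁+n₂, c₁₂)`. -/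
theorem springer_cell_criterion_B1 {k : Type*} [Field k]
    (γ₁ γ₂ γ₃ : LaurentSeries k) (hγ₁ : memO γ₁) (hγ₂ : memO γ₂) (hγ₃ : memO γ₃)
    (h12 : γ₁ ≠ γ₂) (h23 : γ₂ ≠ γ₃) (h13 : γ₁ ≠ γ₃)
    (c₁₂ c₂₃ c₁₃ : ℤ)
    (hc₁₂ : val (γ₁ - γ₂) = (c₁₂ : WithTop ℤ))
    (hc₂₃ : val (γ₂ - γ₃) = (c₂₃ : WithTop ℤ))
    (hc₁₃ : val (γ₁ - γ₃) = (c₁₃ : WithTop ℤ))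
    (n₁ n₂ n₃ : ℤ) (h13' : n₃ ≤ n₁) (h32 : n₂ ≤ n₃) (h2 : 0 ≤ n₂) :
    (∀ b c : LaurentSeries k,
        ((max 0 (n₂ - c₂₃) : ℤ) : WithTop ℤ) ≤ val b →
        ((max (n₁ - n₃) (n₁ - c₁₃) : ℤ) : WithTop ℤ) ≤ val c →
        ∃ a : LaurentSeries k,
          ((0 : ℤ) : WithTop ℤ) ≤ val a ∧
          ((n₁ + n₂ : ℤ) : WithTop ℤ) ≤ val (a * (γ₁ - γ₂) + b * c * (γ₂ - γ₃))) ↔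
      min (n₁ + n₂) c₁₂ ≤ max 0 (n₂ - c₂₃) + max (n₁ - n₃) (n₁ - c₁₃) + c₂₃ := by
  set m := max 0 (n₂ - c₂₃)
  set l := max (n₁ - n₃) (n₁ - c₁₃)
  constructor
  · intro h
    by_contra! hlt
    obtain ⟨hN, hc⟩ := lt_min_iff.mp hlt
    obtain ⟨b, hb⟩ := exists_val_eq (k := k) m
    obtain ⟨c, hc'⟩ := exists_val_eq (k := k) l
    obtain ⟨a, ha, hval⟩ := h b c hb.ge hc'.ge
    have hbc : val (b * c * (γ₂ - γ₃)) = ((m + l + c₂₃ : ℤ) : WithTop ℤ) := by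
      rw [val_mul, val_mul, hb, hc', hc₂₃]
      norm_cast
    have hmul : ((c₁₂ : ℤ) : WithTop ℤ) ≤ val (a * (γ₁ - γ₂)) := by
      rw [val_mul, hc₁₂]
      simpa using add_le_add_left ha (c₁₂ : WithTop ℤ)
    rw [val_add_eq_right_of_lt (hbc ▸ (WithTop.coe_lt_coe.mpr hc).trans_le hmul), hbc] at hval
    exact absurd (WithTop.coe_le_coe.mp hval) hN.not_ge
  · intro h b c hb hc
    have hbc : ((m + l + c₂₃ : ℤ) : WithTop ℤ) ≤ val (b * c * (γ₂ - γ₃)) := by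
      rw [val_mul, val_mul, hc₂₃, WithTop.coe_add, WithTop.coe_add]
      gcongr
    rcases min_le_iff.mp h with hN | hc
    · refine ⟨0, by simp [val_zero], ?_⟩
      rw [zero_mul, zero_add]
      exact (WithTop.coe_le_coe.mpr hN).trans hbc
    · obtain ⟨a, ha, hmul⟩ := exists_mul_eq_of_val_le hc₁₂ ((WithTop.coe_le_coe.mpr hc).trans hbc)
      refine ⟨-a, ?_, ?_⟩
      · rwa [val, HahnSeries.orderTop_neg]
      · rw [neg_mul, hmul, neg_add_cancel, val_zero]
        exact le_top
end
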